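/- Let k be a positive natural number and let n : Fin k → Fin k → ℝ be a matrix of nonnegative transition counts with total count N = Σ_{i,j} n i j > 0 and with every row sum r i = Σ_j n i j positive and every column sum c j = Σ_i n i j positive. Then the test statistic α = 2 · Σ_{i,j} n i j · log ((n i j / r i) / (c j / N)) (with summands taken to be 0 when n i j = 0) equals 0 if and only if n i j = r i · c j / N for all i and j. -/

import Mathlib

/-- Equality case of the G-test statistic: `α = 0` iff the counts factor as the
product of their marginals, `n i j = r i * c j / N` for all `i`, `j`. -/
theorem g_test_statistic_eq_zero_iff (k : ℕ) (hk : 0 < k) (n : Fin k → Fin k → ℝ)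
    (hn : ∀ i j, 0 ≤ n i j)
    (N : ℝ) (hN : N = ∑ i, ∑ j, n i j) (hNpos : 0 < N)
    (r : Fin k → ℝ) (hr : ∀ i, r i = ∑ j, n i j) (hrpos : ∀ i, 0 < r i)
    (c : Fin k → ℝ) (hc : ∀ j, c j = ∑ i, n i j) (hcpos : ∀ j, 0 < c j) :
    (2 * ∑ i, ∑ j,
        (if n i j = 0 then 0 else n i j * Real.log ((n i j / r i) / (c j / N))) = 0)
      ↔ ∀ i j, n i j = r i * c j / N := by
  have hm : ∀ i j, 0 < r i * c j / N := fun i j =>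
    div_pos (mul_pos (hrpos i) (hcpos j)) hNpos
  have hx : ∀ i j, 0 ≤ n i j / (r i * c j / N) := fun i j => div_nonneg (hn i j) (hm i j).le
  have hterm : ∀ i j,
      (if n i j = 0 then 0 else n i j * Real.log ((n i j / r i) / (c j / N)))
        = (r i * c j / N) * InformationTheory.klFun (n i j / (r i * c j / N))
          + (n i j - r i * c j / N) := by
    intro i j
    have h1 := (hrpos i).ne'
    have h2 := (hcpos j).ne'
    have h3 := hNpos.ne'
    have e : (n i j / r i) / (c j / N) = n i j / (r i * c j / N) := by
      field_simp
    have e2 : (r i * c j / N) * (n i j / (r i * c j / N)) = n i j :=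
      mul_div_cancel₀ _ (hm i j).ne'
    rw [e, InformationTheory.klFun_apply]
    split_ifs with h
    · simp [h]
    · linear_combination (1 - Real.log (n i j / (r i * c j / N))) * e2
  have hrs : ∑ i, r i = N := by
    rw [hN]; exact Finset.sum_congr rfl fun i _ => hr i
  have hcs : ∑ j, c j = N := by
    rw [hN, Finset.sum_comm]; exact Finset.sum_congr rfl fun j _ => hc j
  have hms : ∑ i, ∑ j, r i * c j / N = N := by
    simp_rw [← Finset.sum_div, ← Finset.mul_sum, hcs, ← Finset.sum_mul, hrs]
    field_simp
  have hnn : ∀ i j, 0 ≤ (r i * c j / N) * InformationTheory.klFun (n i j / (r i * c j / N)) :=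
    fun i j => mul_nonneg (hm i j).le (InformationTheory.klFun_nonneg (hx i j))
  simp_rw [hterm, Finset.sum_add_distrib, Finset.sum_sub_distrib]
  rw [hms, ← hN, sub_self, add_zero, mul_eq_zero, or_iff_right (two_ne_zero),
    Finset.sum_eq_zero_iff_of_nonneg (fun i _ => Finset.sum_nonneg fun j _ => hnn i j)]
  simp only [Finset.mem_univ, true_imp_iff]
  refine forall_congr' fun i => ?_
  rw [Finset.sum_eq_zero_iff_of_nonneg (fun j _ => hnn i j)]
  simp only [Finset.mem_univ, true_imp_iff]
  refine forall_congr' fun j => ?_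
  rw [mul_eq_zero, or_iff_right (hm i j).ne', InformationTheory.klFun_eq_zero_iff (hx i j),
    div_eq_one_iff_eq (hm i j).ne']
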